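/- 3.663862 < 8·Λ(π/4) < 3.663863; that is, the volume v₈ of the regular ideal hyperbolic octahedron equals 3.663862 up to six decimal places. -/

import Mathlib

open Real

/-- The Lobachevsky function `Λ(x) = -∫₀ˣ log |2 sin t| dt`. -/
noncomputable def lobachevsky (x : ℝ) : ℝ :=
  -∫ t in (0:ℝ)..x, Real.log |2 * Real.sin t|

open Finset in
/-- The partial sums of the sine and cosine series alternately bound the functions on `[0, ∞)`. -/
lemma neg_one_pow_mul_cos_sin_sub_sum_nonneg (n : ℕ) :
    (∀ x : ℝ, 0 ≤ x → 0 ≤ (-1) ^ (n + 1) *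
      (cos x - ∑ k ∈ range (n + 1), (-1) ^ k * x ^ (2 * k) / (2 * k).factorial)) ∧
    (∀ x : ℝ, 0 ≤ x → 0 ≤ (-1) ^ (n + 1) *
      (sin x - ∑ k ∈ range (n + 1), (-1) ^ k * x ^ (2 * k + 1) / (2 * k + 1).factorial)) := by
  have nonneg_of_deriv {f f' : ℝ → ℝ} (hf : ∀ x, HasDerivAt f (f' x) x) (h0 : f 0 = 0)
      (hf' : ∀ x, 0 ≤ x → 0 ≤ f' x) (x : ℝ) (hx : 0 ≤ x) : 0 ≤ f x := by
    have hmono : MonotoneOn f (Set.Ici 0) :=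
      monotoneOn_of_hasDerivWithinAt_nonneg (convex_Ici 0)
        (fun y _ ↦ (hf y).continuousAt.continuousWithinAt)
        (fun y _ ↦ (hf y).hasDerivWithinAt)
        (fun y hy ↦ hf' y (interior_subset hy))
    simpa [h0] using hmono Set.self_mem_Ici hx hx
  have hasDerivAt_monomial (c : ℝ) (m : ℕ) (x : ℝ) :
      HasDerivAt (fun x : ℝ ↦ c * x ^ (m + 1) / (m + 1).factorial)
        (c * x ^ m / m.factorial) x := by
    refine (((hasDerivAt_pow (m + 1) x).const_mul c).div_const _).congr_deriv ?_
    rw [Nat.factorial_succ]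
    push_cast
    field_simp
  have sin_of_cos (n : ℕ) (h : ∀ x : ℝ, 0 ≤ x → 0 ≤ (-1) ^ (n + 1) *
      (cos x - ∑ k ∈ range (n + 1), (-1) ^ k * x ^ (2 * k) / (2 * k).factorial)) :
      ∀ x : ℝ, 0 ≤ x → 0 ≤ (-1) ^ (n + 1) *
      (sin x - ∑ k ∈ range (n + 1), (-1) ^ k * x ^ (2 * k + 1) / (2 * k + 1).factorial) := by
    refine nonneg_of_deriv (fun x ↦ ?_) (by simp) h
    exact ((hasDerivAt_sin x).sub
      (HasDerivAt.fun_sum fun k _ ↦ hasDerivAt_monomial _ _ x)).const_mul _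
  induction n with
  | zero =>
    have h (x : ℝ) (_ : 0 ≤ x) : 0 ≤ (-1) ^ (0 + 1) *
        (cos x - ∑ k ∈ range (0 + 1), (-1) ^ k * x ^ (2 * k) / (2 * k).factorial) := by
      simpa using cos_le_one x
    exact ⟨h, sin_of_cos 0 h⟩
  | succ n ih =>
    have h : ∀ x : ℝ, 0 ≤ x → 0 ≤ (-1) ^ (n + 1 + 1) *
        (cos x - ∑ k ∈ range (n + 1 + 1), (-1) ^ k * x ^ (2 * k) / (2 * k).factorial) := by
      refine nonneg_of_deriv (fun x ↦ ?_) (by simp [sum_range_succ']) ih.2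
      simp_rw [sum_range_succ' _ (n + 1), mul_zero, pow_zero, mul_add_one]
      refine (((hasDerivAt_cos x).sub ((HasDerivAt.fun_sum fun k _ ↦
        hasDerivAt_monomial ((-1) ^ (k + 1)) (2 * k + 1) x).add_const _)).const_mul _).congr_deriv ?_
      simp only [pow_succ _ (n + 1), pow_succ (-1 : ℝ) _, mul_neg, neg_mul, mul_one, neg_div,
        sum_neg_distrib]
      ring
    exact ⟨h, sin_of_cos (n + 1) h⟩

lemma mul_cos_le_mul_sin {t : ℝ} (h0 : 0 ≤ t) (h1 : t ≤ 0.7854) :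
    t * cos t ≤ (1 - t ^ 2 / 3 - t ^ 4 / 45 - 2 * t ^ 6 / 945 - t ^ 8 / 4725
      - 2 / 93555 * t ^ 10) * sin t := by
  have hc := (neg_one_pow_mul_cos_sin_sub_sum_nonneg 6).1 t h0
  have hs := (neg_one_pow_mul_cos_sin_sub_sum_nonneg 7).2 t h0
  norm_num [Finset.sum_range_succ, Nat.factorial] at hc hs
  have hpow (n : ℕ) : t ^ n ≤ 1 := pow_le_one₀ h0 (by linarith)
  have hq : 0 ≤ t ^ 13 * (1382 / 638512875 - 555053 / 3923023104000 * t ^ 2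
      + 373 / 100590336000 * t ^ 4 - 9521 / 176536039680000 * t ^ 6
      + 19 / 37759097376000 * t ^ 8 - 667 / 203899125830400000 * t ^ 10
      + 1 / 61169737749120000 * t ^ 12) := by
    refine mul_nonneg (by positivity) ?_
    have h4 : 0 ≤ t ^ 4 := by positivity
    have h8 : 0 ≤ t ^ 8 := by positivity
    have h12 : 0 ≤ t ^ 12 := by positivity
    linarith [hpow 2, hpow 6, hpow 10]
  have hp : 0 ≤ 1 - t ^ 2 / 3 - t ^ 4 / 45 - 2 * t ^ 6 / 945 - t ^ 8 / 4725
      - 2 / 93555 * t ^ 10 := by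
    linarith [hpow 2, hpow 4, hpow 6, hpow 8, hpow 10]
  refine (mul_le_mul_of_nonneg_left hc h0).trans
    (le_trans ?_ (mul_le_mul_of_nonneg_left hs hp))
  linear_combination hq

lemma mul_sin_le_mul_cos {t : ℝ} (h0 : 0 ≤ t) (h1 : t ≤ 0.7854) :
    (1 - t ^ 2 / 3 - t ^ 4 / 45 - 2 * t ^ 6 / 945 - t ^ 8 / 4725
      - 23 / 1000000 * t ^ 10) * sin t ≤ t * cos t := by
  have hc := (neg_one_pow_mul_cos_sin_sub_sum_nonneg 7).1 t h0
  have hs := (neg_one_pow_mul_cos_sin_sub_sum_nonneg 6).2 t h0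
  norm_num [Finset.sum_range_succ, Nat.factorial] at hc hs
  have hpow (n : ℕ) : t ^ n ≤ 1 := pow_le_one₀ h0 (by linarith)
  have hq : 0 ≤ t ^ 11 * (30353 / 18711000000 - 24874123 / 10216206000000 * t ^ 2
      + 380023601 / 2451889440000000 * t ^ 4 - 823369 / 204324120000000 * t ^ 6
      + 1718863 / 29422673280000000 * t ^ 8 - 14503 / 26747884800000000 * t ^ 10
      + 23 / 6227020800000000 * t ^ 12) := by
    refine mul_nonneg (by positivity) ?_
    have h2 : t ^ 2 ≤ 0.617 := by nlinarith
    have h4 : 0 ≤ t ^ 4 := by positivity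
    have h8 : 0 ≤ t ^ 8 := by positivity
    have h12 : 0 ≤ t ^ 12 := by positivity
    linarith [hpow 6, hpow 10]
  have hp : 0 ≤ 1 - t ^ 2 / 3 - t ^ 4 / 45 - 2 * t ^ 6 / 945 - t ^ 8 / 4725
      - 23 / 1000000 * t ^ 10 := by
    linarith [hpow 2, hpow 4, hpow 6, hpow 8, hpow 10]
  refine (mul_le_mul_of_nonneg_left hs hp).trans
    (le_trans ?_ (mul_le_mul_of_nonneg_left hc h0))
  linear_combination hq

lemma intervalIntegrable_log_abs_two_mul_sin (a b : ℝ) :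
    IntervalIntegrable (fun t ↦ log |2 * sin t|) MeasureTheory.volume a b := by
  simp_rw [← norm_eq_abs]
  apply MeromorphicOn.intervalIntegrable_log_norm
  exact fun x _ ↦ by fun_prop

lemma continuousOn_mul_log_two_mul_sin :
    ContinuousOn (fun t ↦ t * log (2 * sin t)) (Set.Icc 0 (π / 4)) := by
  have hpos : ∀ t ∈ Set.Icc 0 (π / 4), 0 < sinc t := by
    rintro t ⟨h0, h1⟩
    rcases h0.eq_or_lt with rfl | h0
    · simp
    · rw [sinc_of_ne_zero h0.ne']
      exact div_pos (sin_pos_of_pos_of_lt_pi h0 (by linarith [pi_pos])) h0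
  have hcont : ContinuousOn (fun t ↦ t * log t + t * log (2 * sinc t)) (Set.Icc 0 (π / 4)) := by
    refine continuous_mul_log.continuousOn.add (continuousOn_id.mul ?_)
    refine ContinuousOn.log (continuous_sinc.const_mul 2 |>.continuousOn) fun t ht ↦ ?_
    have := hpos t ht
    positivity
  refine hcont.congr fun t ht ↦ ?_
  rcases ht.1.eq_or_lt with rfl | h0
  · simp
  · have hs := hpos t ht
    have : 2 * sin t = t * (2 * sinc t) := by
      rw [sinc_of_ne_zero h0.ne']
      field_simp
    simp only [this]
    rw [log_mul h0.ne' (by positivity)]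
    ring

/-- Here the polynomial is the antiderivative of the truncated power series of `t * cot t`, with a
free last coefficient `c`. -/
lemma hasDerivWithinAt_mul_log_two_mul_sin_sub (c : ℝ) {t : ℝ} (ht : t ∈ Set.Ioo 0 (π / 4)) :
    HasDerivWithinAt (fun t ↦ t * log (2 * sin t) - (t - t ^ 3 / 9 - t ^ 5 / 225
        - 2 * t ^ 7 / 6615 - t ^ 9 / 42525 - c * t ^ 11 / 11))
      (log (2 * sin t) + t * cos t / sin t - (1 - t ^ 2 / 3 - t ^ 4 / 45 - 2 * t ^ 6 / 945
        - t ^ 8 / 4725 - c * t ^ 10)) (Set.Ioi t) t := by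
  have hs : 0 < sin t := sin_pos_of_pos_of_lt_pi ht.1 (by linarith [pi_pos, ht.2])
  have hlog := (hasDerivAt_id t).mul (((hasDerivAt_sin t).const_mul 2).log (by positivity))
  have hpoly := (((((hasDerivAt_id t).sub ((hasDerivAt_pow 3 t).div_const 9)).sub
    ((hasDerivAt_pow 5 t).div_const 225)).sub
    (((hasDerivAt_pow 7 t).const_mul 2).div_const 6615)).sub
    ((hasDerivAt_pow 9 t).div_const 42525)).sub (((hasDerivAt_pow 11 t).const_mul c).div_const 11)
  refine ((hlog.sub hpoly).congr_deriv ?_).hasDerivWithinAt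
  simp only [id]
  push_cast
  field_simp
  ring

lemma log_two_mul_sin_pi_div_four : log (2 * sin (π / 4)) = log 2 / 2 := by
  rw [sin_pi_div_four, mul_div_cancel₀ _ two_ne_zero, log_sqrt zero_le_two]

lemma continuousOn_mul_log_two_mul_sin_sub (c : ℝ) :
    ContinuousOn (fun t ↦ t * log (2 * sin t) - (t - t ^ 3 / 9 - t ^ 5 / 225
      - 2 * t ^ 7 / 6615 - t ^ 9 / 42525 - c * t ^ 11 / 11)) (Set.Icc 0 (π / 4)) :=
  continuousOn_mul_log_two_mul_sin.sub (by fun_prop)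

lemma pi_div_four_lt : π / 4 < 0.7854 := by linarith [pi_lt_d6]

lemma le_lobachevsky_pi_div_four :
    π / 4 - (π / 4) ^ 3 / 9 - (π / 4) ^ 5 / 225 - 2 * (π / 4) ^ 7 / 6615 - (π / 4) ^ 9 / 42525
      - 23 / 1000000 * (π / 4) ^ 11 / 11 - π / 4 * (log 2 / 2) ≤ lobachevsky (π / 4) := by
  have h := intervalIntegral.integral_le_sub_of_hasDeriv_right_of_le
    (φ := fun t ↦ log |2 * sin t|) (by positivity : 0 ≤ π / 4)
    (continuousOn_mul_log_two_mul_sin_sub (23 / 1000000))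
    (fun t ht ↦ hasDerivWithinAt_mul_log_two_mul_sin_sub _ ht)
    ((intervalIntegrable_iff_integrableOn_Icc_of_le (by positivity)).1
      (intervalIntegrable_log_abs_two_mul_sin _ _)) fun t ht ↦ by
      have hs : 0 < sin t := sin_pos_of_pos_of_lt_pi ht.1 (by linarith [pi_pos, ht.2])
      have := (le_div_iff₀ hs).2 (mul_sin_le_mul_cos ht.1.le (ht.2.trans pi_div_four_lt).le)
      rw [log_abs]
      linarith
  rw [log_two_mul_sin_pi_div_four] at h
  unfold lobachevsky
  norm_num at h ⊢
  linarith

lemma lobachevsky_pi_div_four_le :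
    lobachevsky (π / 4) ≤ π / 4 - (π / 4) ^ 3 / 9 - (π / 4) ^ 5 / 225 - 2 * (π / 4) ^ 7 / 6615
      - (π / 4) ^ 9 / 42525 - 2 / 93555 * (π / 4) ^ 11 / 11 - π / 4 * (log 2 / 2) := by
  have h := intervalIntegral.sub_le_integral_of_hasDeriv_right_of_le
    (φ := fun t ↦ log |2 * sin t|) (by positivity : 0 ≤ π / 4)
    (continuousOn_mul_log_two_mul_sin_sub (2 / 93555))
    (fun t ht ↦ hasDerivWithinAt_mul_log_two_mul_sin_sub _ ht)
    ((intervalIntegrable_iff_integrableOn_Icc_of_le (by positivity)).1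
      (intervalIntegrable_log_abs_two_mul_sin _ _)) fun t ht ↦ by
      have hs : 0 < sin t := sin_pos_of_pos_of_lt_pi ht.1 (by linarith [pi_pos, ht.2])
      have := (div_le_iff₀ hs).2 (mul_cos_le_mul_sin ht.1.le (ht.2.trans pi_div_four_lt).le)
      rw [log_abs]
      linarith
  rw [log_two_mul_sin_pi_div_four] at h
  unfold lobachevsky
  norm_num at h ⊢
  linarith

/-- `v₈ = 8Λ(π/4)`, the volume of the regular ideal hyperbolic octahedron,
equals `3.663862` up to six decimal places. -/
theorem v8_approx :
    3.663862 < 8 * lobachevsky (Real.pi / 4) ∧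
      8 * lobachevsky (Real.pi / 4) < 3.663863 := by
  have hlo := le_lobachevsky_pi_div_four
  have hhi := lobachevsky_pi_div_four_le
  have hx : 0.785398163 < π / 4 := by linarith [pi_gt_d20]
  have hx' : π / 4 < 0.785398164 := by linarith [pi_lt_d20]
  generalize π / 4 = x at *
  have hl := log_two_gt_d9
  have hl' := log_two_lt_d9
  generalize log 2 = l at *
  have pow_lower (n : ℕ) : 0.785398163 ^ n ≤ x ^ n := by gcongr
  have pow_upper (n : ℕ) : x ^ n ≤ 0.785398164 ^ n := by gcongr
  have hxl : x * l ≤ 0.785398164 * 0.6931471808 := by gcongr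
  have hxl' : 0.785398163 * 0.6931471803 ≤ x * l := by gcongr
  have h3 := pow_lower 3
  have h5 := pow_lower 5
  have h7 := pow_lower 7
  have h9 := pow_lower 9
  have h11 := pow_lower 11
  have h3' := pow_upper 3
  have h5' := pow_upper 5
  have h7' := pow_upper 7
  have h9' := pow_upper 9
  have h11' := pow_upper 11
  norm_num at *
  constructor <;> linarith
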